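/- Let γ = 1/2 and assume 2α = σ². Let P be a complete solution of the bond pricing PDE. Then for all τ ∈ (0,T), (d/dτ) ∫₀^∞ P(τ,r)² dr ≤ K ∫₀^∞ P(τ,r)² dr with K = −β. -/

import Mathlib

open Set MeasureTheory Real Filter Topology Asymptotics

noncomputable section

/-- Partial derivative of `P = P(τ,r)` with respect to `τ`. -/
def pTau (P : ℝ → ℝ → ℝ) (τ r : ℝ) : ℝ := deriv (fun t => P t r) τ

/-- Partial derivative of `P = P(τ,r)` with respect to `r`. -/
def pR (P : ℝ → ℝ → ℝ) (τ r : ℝ) : ℝ := deriv (fun x => P τ x) r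

/-- Second partial derivative of `P = P(τ,r)` with respect to `r`. -/
def pRR (P : ℝ → ℝ → ℝ) (τ r : ℝ) : ℝ := deriv (fun x => pR P τ x) r

/-- A complete solution of the bond pricing PDE
`-∂_τ P + (1/2) σ² r^{2γ} ∂²_r P + (α + β r) ∂_r P - r P = 0`
on `r > 0`, `τ ∈ (0,T)`, with initial condition `P(0,r) = 1`, continuous partial
derivatives on `[0,∞) × (0,T)` and the growth conditions
`|P(τ,r)| ≤ M e^{-m r^δ}`, `|∂_r P(τ,r)| ≤ M`. -/
structure IsCompleteSolution (σ α β γ T : ℝ) (P : ℝ → ℝ → ℝ) : Prop where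
  diff_tau : ∀ τ ∈ Ioo (0:ℝ) T, ∀ r ∈ Ici (0:ℝ), DifferentiableAt ℝ (fun t => P t r) τ
  diff_r : ∀ τ ∈ Ioo (0:ℝ) T, ∀ r ∈ Ici (0:ℝ), DifferentiableAt ℝ (fun x => P τ x) r
  diff_rr : ∀ τ ∈ Ioo (0:ℝ) T, ∀ r ∈ Ici (0:ℝ), DifferentiableAt ℝ (fun x => pR P τ x) r
  cont_tau : ContinuousOn (fun p : ℝ × ℝ => pTau P p.1 p.2) (Ioo 0 T ×ˢ Ici 0)
  cont_r : ContinuousOn (fun p : ℝ × ℝ => pR P p.1 p.2) (Ioo 0 T ×ˢ Ici 0)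
  cont_rr : ContinuousOn (fun p : ℝ × ℝ => pRR P p.1 p.2) (Ioo 0 T ×ˢ Ici 0)
  pde : ∀ τ ∈ Ioo (0:ℝ) T, ∀ r : ℝ, 0 < r →
      -pTau P τ r + (1/2) * σ^2 * r ^ (2*γ) * pRR P τ r
        + (α + β * r) * pR P τ r - r * P τ r = 0
  init : ∀ r : ℝ, 0 ≤ r → P 0 r = 1
  growth : ∃ M m δ : ℝ, 0 < M ∧ 0 < m ∧ 0 < δ ∧
      ∀ τ ∈ Ioo (0:ℝ) T, ∀ r : ℝ, 0 < r →
        |P τ r| ≤ M * Real.exp (-m * r ^ δ) ∧ |pR P τ r| ≤ M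

namespace IsCompleteSolution

variable {σ α β γ T : ℝ} {P : ℝ → ℝ → ℝ} {t A B : ℝ}

section Regularity

variable (hP : IsCompleteSolution σ α β γ T P)
include hP

theorem hasDerivAt_tau (ht : t ∈ Ioo 0 T) {r : ℝ} (hr : 0 ≤ r) :
    HasDerivAt (fun s => P s r) (pTau P t r) t :=
  (hP.diff_tau t ht r hr).hasDerivAt

theorem hasDerivAt_r (ht : t ∈ Ioo 0 T) {r : ℝ} (hr : 0 ≤ r) :
    HasDerivAt (fun x => P t x) (pR P t r) r :=
  (hP.diff_r t ht r hr).hasDerivAt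

theorem hasDerivAt_rr (ht : t ∈ Ioo 0 T) {r : ℝ} (hr : 0 ≤ r) :
    HasDerivAt (fun x => pR P t x) (pRR P t r) r :=
  (hP.diff_rr t ht r hr).hasDerivAt

theorem continuousOn_slice (ht : t ∈ Ioo 0 T) (hA : 0 ≤ A) :
    ContinuousOn (fun r => P t r) (Icc A B) := fun _ hr =>
  (hP.hasDerivAt_r ht (hA.trans hr.1)).continuousAt.continuousWithinAt

theorem continuousOn_pR_slice (ht : t ∈ Ioo 0 T) (hA : 0 ≤ A) :
    ContinuousOn (fun r => pR P t r) (Icc A B) := fun _ hr =>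
  (hP.hasDerivAt_rr ht (hA.trans hr.1)).continuousAt.continuousWithinAt

theorem continuousOn_pRR_slice (ht : t ∈ Ioo 0 T) (hA : 0 ≤ A) :
    ContinuousOn (fun r => pRR P t r) (Icc A B) :=
  hP.cont_rr.comp (f := fun r : ℝ => (t, r)) (by fun_prop) fun _ hr => ⟨ht, hA.trans hr.1⟩

theorem continuousOn_pTau_slice (ht : t ∈ Ioo 0 T) (hA : 0 ≤ A) :
    ContinuousOn (fun r => pTau P t r) (Icc A B) :=
  hP.cont_tau.comp (f := fun r : ℝ => (t, r)) (by fun_prop) fun _ hr => ⟨ht, hA.trans hr.1⟩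

end Regularity

theorem exists_bound_of_continuousOn {f : ℝ → ℝ → ℝ}
    (hf : ContinuousOn (fun p : ℝ × ℝ => f p.1 p.2) (Ioo 0 T ×ˢ Ici 0)) {a b : ℝ}
    (ha : 0 < a) (hb : b < T) (hA : 0 ≤ A) :
    ∃ C, ∀ s ∈ Icc a b, ∀ r ∈ Icc A B, |f s r| ≤ C := by
  obtain ⟨C, hC⟩ := ((isCompact_Icc (a := a) (b := b)).prod
    (isCompact_Icc (a := A) (b := B))).exists_bound_of_continuousOn
      (hf.mono (prod_mono (fun s hs => ⟨ha.trans_le hs.1, hs.2.trans_lt hb⟩)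
        fun r hr => hA.trans hr.1))
  exact ⟨C, fun s hs r hr => hC (s, r) ⟨hs, hr⟩⟩

theorem aestronglyMeasurable_uIoc {f : ℝ → ℝ} (hAB : A ≤ B) (hf : ContinuousOn f (Icc A B)) :
    AEStronglyMeasurable f (volume.restrict (uIoc A B)) := by
  rw [uIoc_of_le hAB]
  exact (hf.mono Ioc_subset_Icc_self).aestronglyMeasurable measurableSet_Ioc

theorem continuousAt_slice_tau {f : ℝ → ℝ → ℝ}
    (hf : ContinuousOn (fun p : ℝ × ℝ => f p.1 p.2) (Ioo 0 T ×ˢ Ici 0)) (ht : t ∈ Ioo 0 T)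
    {r : ℝ} (hr : 0 ≤ r) : ContinuousAt (fun s => f s r) t :=
  (hf.comp (f := fun s : ℝ => (s, r)) (s := Ioo 0 T) (by fun_prop)
    fun _ hs => ⟨hs, hr⟩).continuousAt (isOpen_Ioo.mem_nhds ht)

/-- Differentiation under the integral sign for weighted `L²` norms on bounded intervals. -/
theorem hasDerivAt_integral_sq (hP : IsCompleteSolution σ α β γ T P) (ht : t ∈ Ioo 0 T)
    (hA : 0 ≤ A) (hAB : A ≤ B) {w : ℝ → ℝ} (hw : Continuous w) :
    HasDerivAt (fun s => ∫ r in A..B, w r * P s r ^ 2)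
      (∫ r in A..B, w r * (2 * P t r * pTau P t r)) t := by
  obtain ⟨M, m, δ, hM, hm, -, hgr⟩ := hP.growth
  obtain ⟨a, ha, hat⟩ := exists_between ht.1
  obtain ⟨b, htb, hb⟩ := exists_between ht.2
  have hsub : Ioo a b ⊆ Ioo 0 T := Ioo_subset_Ioo ha.le hb.le
  obtain ⟨C, hC⟩ := exists_bound_of_continuousOn (A := A) (B := B) hP.cont_tau ha hb hA
  have hbd : ∀ s ∈ Ioo (0:ℝ) T, ∀ r, 0 < r → |P s r| ≤ M := fun s hs r hr => by
    refine (hgr s hs r hr).1.trans (mul_le_of_le_one_right hM.le (Real.exp_le_one_iff.2 ?_))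
    have := Real.rpow_nonneg hr.le δ
    nlinarith
  have hnhds : Ioo a b ∈ 𝓝 t := Ioo_mem_nhds hat htb
  refine (intervalIntegral.hasDerivAt_integral_of_dominated_loc_of_deriv_le
    (F := fun s r => w r * P s r ^ 2) (F' := fun s r => w r * (2 * P s r * pTau P s r))
    (bound := fun r => |w r| * (2 * M * C)) hnhds ?_ ?_ ?_ ?_ ?_ ?_).2
  · filter_upwards [hnhds] with s hs
    exact aestronglyMeasurable_uIoc hAB
      (hw.continuousOn.mul ((hP.continuousOn_slice (hsub hs) hA).pow 2))
  · exact (hw.continuousOn.mul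
      ((hP.continuousOn_slice ht hA).pow 2)).intervalIntegrable_of_Icc hAB
  · exact aestronglyMeasurable_uIoc hAB (hw.continuousOn.mul
      ((continuousOn_const.mul (hP.continuousOn_slice ht hA)).mul
        (hP.continuousOn_pTau_slice ht hA)))
  · refine Eventually.of_forall fun r hr s hs => ?_
    rw [uIoc_of_le hAB] at hr
    rw [Real.norm_eq_abs, abs_mul, abs_mul, abs_mul, abs_two]
    have h1 := hbd s (hsub hs) r (hA.trans_lt hr.1)
    have h2 := hC s (Ioo_subset_Icc_self hs) r (Ioc_subset_Icc_self hr)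
    gcongr
  · exact Continuous.intervalIntegrable (by fun_prop) _ _
  · refine Eventually.of_forall fun r hr s hs => ?_
    rw [uIoc_of_le hAB] at hr
    have := ((hP.hasDerivAt_tau (hsub hs) (hA.trans hr.1.le)).pow 2).const_mul (w r)
    simpa using this

/-- The time derivative of a weighted Dirichlet integral whose weight vanishes at the end points;
no mixed derivative of `P` is required. -/
theorem hasDerivAt_integral_pR_sq (hP : IsCompleteSolution σ α β γ T P) (ht : t ∈ Ioo 0 T)
    (hA : 0 ≤ A) (hAB : A ≤ B) {w w' : ℝ → ℝ} (hw : ∀ r, HasDerivAt w (w' r) r)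
    (hw' : Continuous w') (hwA : w A = 0) (hwB : w B = 0) :
    HasDerivAt (fun s => ∫ r in A..B, w r * pR P s r ^ 2)
      (∫ r in A..B, -pTau P t r * (w' r * (pR P t r + pR P t r)
        + w r * (pRR P t r + pRR P t r))) t := by
  have hwc : Continuous w := continuous_iff_continuousAt.2 fun r => (hw r).continuousAt
  obtain ⟨a, ha, hat⟩ := exists_between ht.1
  obtain ⟨b, htb, hb⟩ := exists_between ht.2
  have hsub : Ioo a b ⊆ Ioo 0 T := Ioo_subset_Ioo ha.le hb.le
  obtain ⟨C₀, hC₀⟩ := exists_bound_of_continuousOn (A := A) (B := B) hP.cont_tau ha hb hA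
  obtain ⟨C₁, hC₁⟩ := exists_bound_of_continuousOn (A := A) (B := B) hP.cont_r ha hb hA
  obtain ⟨C₂, hC₂⟩ := exists_bound_of_continuousOn (A := A) (B := B) hP.cont_rr ha hb hA
  have htI : t ∈ Ioo a b := ⟨hat, htb⟩
  have hnhds : ∀ᶠ s in 𝓝[≠] t, s ∈ Ioo a b := mem_nhdsWithin_of_mem_nhds (Ioo_mem_nhds hat htb)
  have hslope : ∀ s ∈ Ioo a b, ∀ r ∈ Icc A B, |slope (fun s => P s r) t s| ≤ C₀ := by
    intro s hs r hr
    have hr0 : 0 ≤ r := hA.trans hr.1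
    have hC0 : 0 ≤ C₀ := (abs_nonneg _).trans (hC₀ t (Ioo_subset_Icc_self htI) r hr)
    have := (convex_Ioo a b).norm_image_sub_le_of_norm_hasDerivWithin_le
      (f := fun s => P s r) (f' := fun s => pTau P s r) (C := C₀)
      (fun x hx => (hP.hasDerivAt_tau (hsub hx) hr0).hasDerivWithinAt)
      (fun x hx => hC₀ x (Ioo_subset_Icc_self hx) r hr) htI hs
    rw [slope_def_field, abs_div]
    exact div_le_of_le_mul₀ (abs_nonneg _) hC0 this
  rw [hasDerivAt_iff_tendsto_slope]
  have key : ∀ᶠ s in 𝓝[≠] t, (∫ r in A..B, -slope (fun s => P s r) t s *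
      (w' r * (pR P s r + pR P t r) + w r * (pRR P s r + pRR P t r))) =
      slope (fun s => ∫ r in A..B, w r * pR P s r ^ 2) t s := by
    filter_upwards [hnhds] with s hsI
    have hs := hsub hsI
    have cs := hP.continuousOn_pR_slice (B := B) hs hA
    have ct := hP.continuousOn_pR_slice (B := B) ht hA
    have css := hP.continuousOn_pRR_slice (B := B) hs hA
    have ctt := hP.continuousOn_pRR_slice (B := B) ht hA
    have c0s := hP.continuousOn_slice (B := B) hs hA
    have c0t := hP.continuousOn_slice (B := B) ht hA
    have hIBP := intervalIntegral.integral_deriv_mul_eq_sub (a := A) (b := B)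
      (u := fun r => P s r - P t r) (u' := fun r => pR P s r - pR P t r)
      (v := fun r => w r * (pR P s r + pR P t r))
      (v' := fun r => w' r * (pR P s r + pR P t r) + w r * (pRR P s r + pRR P t r))
      (fun r hr => by
        rw [uIcc_of_le hAB] at hr
        exact (hP.hasDerivAt_r hs (hA.trans hr.1)).sub (hP.hasDerivAt_r ht (hA.trans hr.1)))
      (fun r hr => by
        rw [uIcc_of_le hAB] at hr
        exact (hw r).mul
          ((hP.hasDerivAt_rr hs (hA.trans hr.1)).add (hP.hasDerivAt_rr ht (hA.trans hr.1))))
      ((cs.sub ct).intervalIntegrable_of_Icc hAB)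
      (((hw'.continuousOn.mul (cs.add ct)).add
        (hwc.continuousOn.mul (css.add ctt))).intervalIntegrable_of_Icc hAB)
    rw [hwA, hwB, zero_mul, zero_mul, mul_zero, mul_zero, sub_zero] at hIBP
    have i₁ : IntervalIntegrable (fun r => w r * pR P s r ^ 2) volume A B :=
      (hwc.continuousOn.mul (cs.pow 2)).intervalIntegrable_of_Icc hAB
    have i₂ : IntervalIntegrable (fun r => w r * pR P t r ^ 2) volume A B :=
      (hwc.continuousOn.mul (ct.pow 2)).intervalIntegrable_of_Icc hAB
    have i₃ : IntervalIntegrable (fun r => (pR P s r - pR P t r) * (w r * (pR P s r + pR P t r)) +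
        (P s r - P t r) * (w' r * (pR P s r + pR P t r) + w r * (pRR P s r + pRR P t r)))
        volume A B :=
      (((cs.sub ct).mul (hwc.continuousOn.mul (cs.add ct))).add
        ((c0s.sub c0t).mul ((hw'.continuousOn.mul (cs.add ct)).add
        (hwc.continuousOn.mul (css.add ctt))))).intervalIntegrable_of_Icc hAB
    rw [slope_def_field, ← intervalIntegral.integral_sub i₁ i₂, ← sub_zero
      (∫ r in A..B, (w r * pR P s r ^ 2 - w r * pR P t r ^ 2)), ← hIBP,
      ← intervalIntegral.integral_sub (i₁.sub i₂) i₃, ← intervalIntegral.integral_div]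
    refine intervalIntegral.integral_congr fun r _ => ?_
    simp only [slope_def_field]
    ring
  refine Tendsto.congr' key ?_
  refine intervalIntegral.tendsto_integral_filter_of_dominated_convergence
    (fun r => C₀ * (|w' r| * (C₁ + C₁) + |w r| * (C₂ + C₂))) ?_ ?_ ?_ ?_
  · filter_upwards [hnhds] with s hsI
    have hs := hsub hsI
    refine aestronglyMeasurable_uIoc hAB (ContinuousOn.mul (ContinuousOn.neg ?_) ?_)
    · simp only [slope_def_field]
      exact ((hP.continuousOn_slice hs hA).sub (hP.continuousOn_slice ht hA)).div_const _
    · exact (hw'.continuousOn.mul ((hP.continuousOn_pR_slice hs hA).add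
        (hP.continuousOn_pR_slice ht hA))).add (hwc.continuousOn.mul
        ((hP.continuousOn_pRR_slice hs hA).add (hP.continuousOn_pRR_slice ht hA)))
  · filter_upwards [hnhds] with s hs
    refine Eventually.of_forall fun r hr => ?_
    rw [uIoc_of_le hAB] at hr
    have hr' := Ioc_subset_Icc_self hr
    have hs' := Ioo_subset_Icc_self hs
    have ht' := Ioo_subset_Icc_self htI
    have h0 := hslope s hs r hr'
    rw [Real.norm_eq_abs, abs_mul, abs_neg]
    have hC0 : 0 ≤ C₀ := (abs_nonneg _).trans h0
    refine mul_le_mul h0 ?_ (abs_nonneg _) hC0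
    refine (abs_add_le _ _).trans ?_
    rw [abs_mul, abs_mul]
    gcongr
    · exact (abs_add_le _ _).trans (add_le_add (hC₁ s hs' r hr') (hC₁ t ht' r hr'))
    · exact (abs_add_le _ _).trans (add_le_add (hC₂ s hs' r hr') (hC₂ t ht' r hr'))
  · exact Continuous.intervalIntegrable (by fun_prop) _ _
  · refine Eventually.of_forall fun r hr => ?_
    rw [uIoc_of_le hAB] at hr
    have hr0 : 0 ≤ r := hA.trans hr.1.le
    have h1 : Tendsto (fun s => pR P s r) (𝓝[≠] t) (𝓝 (pR P t r)) :=
      (continuousAt_slice_tau hP.cont_r ht hr0).tendsto.mono_left nhdsWithin_le_nhds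
    have h2 : Tendsto (fun s => pRR P s r) (𝓝[≠] t) (𝓝 (pRR P t r)) :=
      (continuousAt_slice_tau hP.cont_rr ht hr0).tendsto.mono_left nhdsWithin_le_nhds
    have h3 := hasDerivAt_iff_tendsto_slope.1 (hP.hasDerivAt_tau ht hr0)
    exact h3.neg.mul (((h1.add_const _).const_mul _).add ((h2.add_const _).const_mul _))

/-- Products of `P` with `P` and `∂_r P` decay faster than `r⁻⁶`, uniformly in time. -/
theorem exists_decay (hP : IsCompleteSolution σ α β γ T P) {ε : ℝ} (hε : 0 < ε) :
    ∃ A₀, 1 ≤ A₀ ∧ ∀ t ∈ Ioo (0:ℝ) T, ∀ r, A₀ ≤ r →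
      r ^ 6 * |P t r * pR P t r| ≤ ε ∧ r ^ 6 * P t r ^ 2 ≤ ε := by
  obtain ⟨M, m, δ, hM, hm, hδ, hgr⟩ := hP.growth
  have hlim : Tendsto (fun r : ℝ => M ^ 2 * ((r ^ δ) ^ (6 / δ) * Real.exp (-m * r ^ δ)))
      atTop (𝓝 0) := by
    simpa using ((tendsto_rpow_mul_exp_neg_mul_atTop_nhds_zero (6 / δ) m hm).comp
      (tendsto_rpow_atTop hδ)).const_mul (M ^ 2)
  obtain ⟨A₁, hA₁⟩ := eventually_atTop.1 (hlim.eventually (ge_mem_nhds hε))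
  refine ⟨max A₁ 1, le_max_right _ _, fun t ht r hr => ?_⟩
  have hr0 : 0 < r := one_pos.trans_le ((le_max_right _ _).trans hr)
  have h := hA₁ r ((le_max_left _ _).trans hr)
  have hpow : (r ^ δ) ^ (6 / δ) = r ^ 6 := by
    rw [← Real.rpow_mul hr0.le, mul_div_cancel₀ _ hδ.ne']
    exact_mod_cast Real.rpow_natCast r 6
  rw [hpow] at h
  obtain ⟨h1, h2⟩ := hgr t ht r hr0
  have hexp : Real.exp (-m * r ^ δ) ≤ 1 := by
    refine Real.exp_le_one_iff.2 ?_
    have := Real.rpow_nonneg hr0.le δ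
    nlinarith
  have h1' : |P t r| ≤ M := h1.trans (mul_le_of_le_one_right hM.le hexp)
  have hbound : ∀ y, |y| ≤ M → r ^ 6 * (|P t r| * |y|) ≤ ε := fun y hy => calc
    r ^ 6 * (|P t r| * |y|) ≤ r ^ 6 * (M * Real.exp (-m * r ^ δ) * M) := by gcongr
    _ = M ^ 2 * (r ^ 6 * Real.exp (-m * r ^ δ)) := by ring
    _ ≤ ε := h
  refine ⟨by rw [abs_mul]; exact hbound _ h2, ?_⟩
  rw [← sq_abs, sq]
  exact hbound _ h1'

theorem abs_integral_le_of_sq_mul_le {f : ℝ → ℝ} {ε : ℝ} (hε : 0 ≤ ε) (hA : 1 ≤ A) (hAB : A ≤ B)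
    (hf : ∀ r ∈ Icc A B, r ^ 2 * |f r| ≤ ε) : |∫ r in A..B, f r| ≤ ε := by
  have hne : ∀ r ∈ uIcc A B, r ≠ 0 := fun r hr => by
    rw [uIcc_of_le hAB] at hr
    linarith [hr.1]
  have hint : IntervalIntegrable (fun r : ℝ => ε * (r ^ 2)⁻¹) volume A B :=
    ContinuousOn.intervalIntegrable
      (continuousOn_const.mul ((continuousOn_pow 2).inv₀ fun r hr => pow_ne_zero 2 (hne r hr)))
  have hval : ∫ r in A..B, ε * (r ^ 2)⁻¹ = -(ε * B⁻¹) - -(ε * A⁻¹) := by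
    refine intervalIntegral.integral_eq_sub_of_hasDerivAt (f := fun r => -(ε * r⁻¹))
      (fun r hr => ?_) hint
    refine ((hasDerivAt_inv (hne r hr)).const_mul ε).neg.congr_deriv ?_
    ring
  have h := intervalIntegral.norm_integral_le_of_norm_le hAB (f := f)
    (Eventually.of_forall fun r hr => ?_) hint
  · have hB : 0 ≤ ε * B⁻¹ := mul_nonneg hε (inv_nonneg.2 (by linarith))
    have hA' : ε * A⁻¹ ≤ ε := mul_le_of_le_one_right hε (inv_le_one_of_one_le₀ hA)
    rw [Real.norm_eq_abs, hval] at h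
    linarith
  · have hr0 : 0 < r := by linarith [hr.1]
    rw [← div_eq_mul_inv, le_div_iff₀ (by positivity), mul_comm]
    exact hf r (Ioc_subset_Icc_self hr)

theorem pde_cir (hP : IsCompleteSolution σ α β (1 / 2) T P) (h2α : 2 * α = σ ^ 2)
    (ht : t ∈ Ioo 0 T) {r : ℝ} (hr : 0 < r) :
    pTau P t r = α * (r * pRR P t r + pR P t r) + β * r * pR P t r - r * P t r := by
  have h := hP.pde t ht r hr
  rw [← h2α, show (2 : ℝ) * (1 / 2) = 1 by norm_num, Real.rpow_one] at h
  linarith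

/-- The energy identity with the weight `r ^ k`. -/
theorem energy_identity (hP : IsCompleteSolution σ α β (1 / 2) T P) (h2α : 2 * α = σ ^ 2)
    (ht : t ∈ Ioo 0 T) (hA : 0 ≤ A) (hAB : A ≤ B) (k : ℕ) :
    (∫ r in A..B, r ^ k * (2 * P t r * pTau P t r))
        + 2 * α * ∫ r in A..B, r ^ (k + 1) * pR P t r ^ 2 =
      2 * α * (B ^ (k + 1) * (P t B * pR P t B)) - 2 * α * (A ^ (k + 1) * (P t A * pR P t A))
        + (∫ r in A..B, (2 * β * r ^ (k + 1) - 2 * α * k * r ^ k) * (P t r * pR P t r))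
        - ∫ r in A..B, 2 * r ^ (k + 1) * P t r ^ 2 := by
  have c0 := hP.continuousOn_slice (B := B) ht hA
  have c1 := hP.continuousOn_pR_slice (B := B) ht hA
  have c2 := hP.continuousOn_pRR_slice (B := B) ht hA
  have cτ := hP.continuousOn_pTau_slice (B := B) ht hA
  have hFTC := intervalIntegral.integral_eq_sub_of_hasDerivAt (a := A) (b := B)
    (f := fun r => 2 * α * (r ^ (k + 1) * (P t r * pR P t r)))
    (f' := fun r => 2 * α * ((k + 1) * r ^ k * (P t r * pR P t r) +
      r ^ (k + 1) * (pR P t r * pR P t r + P t r * pRR P t r)))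
    (fun r hr => by
      rw [uIcc_of_le hAB] at hr
      have hr0 := hA.trans hr.1
      have := ((hasDerivAt_pow (k + 1) r).mul
        ((hP.hasDerivAt_r ht hr0).mul (hP.hasDerivAt_rr ht hr0))).const_mul (2 * α)
      simpa using this)
    (ContinuousOn.intervalIntegrable_of_Icc hAB (by fun_prop))
  have i₁ : IntervalIntegrable (fun r => r ^ k * (2 * P t r * pTau P t r)) volume A B :=
    ContinuousOn.intervalIntegrable_of_Icc hAB (by fun_prop)
  have i₂ : IntervalIntegrable (fun r => 2 * α * (r ^ (k + 1) * pR P t r ^ 2)) volume A B :=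
    ContinuousOn.intervalIntegrable_of_Icc hAB (by fun_prop)
  have i₃ : IntervalIntegrable
      (fun r => (2 * β * r ^ (k + 1) - 2 * α * k * r ^ k) * (P t r * pR P t r)) volume A B :=
    ContinuousOn.intervalIntegrable_of_Icc hAB (by fun_prop)
  have i₄ : IntervalIntegrable (fun r => 2 * r ^ (k + 1) * P t r ^ 2) volume A B :=
    ContinuousOn.intervalIntegrable_of_Icc hAB (by fun_prop)
  have i₅ : IntervalIntegrable (fun r => 2 * α * ((k + 1) * r ^ k * (P t r * pR P t r) +
      r ^ (k + 1) * (pR P t r * pR P t r + P t r * pRR P t r))) volume A B :=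
    ContinuousOn.intervalIntegrable_of_Icc hAB (by fun_prop)
  rw [← hFTC, ← intervalIntegral.integral_const_mul, ← intervalIntegral.integral_add i₁ i₂,
    ← intervalIntegral.integral_add i₅ i₃, ← intervalIntegral.integral_sub (i₅.add i₃) i₄]
  refine intervalIntegral.integral_congr_Ioo_of_le hAB fun r hr => ?_
  simp only [hP.pde_cir h2α ht (hA.trans_lt hr.1)]
  ring

/-- Far out, the weighted energy is dissipated up to a small error. -/
theorem abs_energy_add_dissipation_le (hP : IsCompleteSolution σ α β (1 / 2) T P)
    (h2α : 2 * α = σ ^ 2) (hα : 0 < α) (ht : t ∈ Ioo 0 T) (hA : 1 ≤ A) (hAB : A ≤ B)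
    {k : ℕ} (hk : k ≤ 3) {ε : ℝ} (hdec : ∀ r, A ≤ r →
      r ^ 6 * |P t r * pR P t r| ≤ ε ∧ r ^ 6 * P t r ^ 2 ≤ ε) :
    |(∫ r in A..B, r ^ k * (2 * P t r * pTau P t r))
        + 2 * α * ∫ r in A..B, r ^ (k + 1) * pR P t r ^ 2|
      ≤ (10 * α + 2 * |β| + 2) * ε := by
  have hA0 : 0 ≤ A := zero_le_one.trans hA
  have hε : 0 ≤ ε := le_trans (by positivity) (hdec A le_rfl).2
  have hk' : (k : ℝ) ≤ 3 := by exact_mod_cast hk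
  have hbd : ∀ r, A ≤ r → |2 * α * (r ^ (k + 1) * (P t r * pR P t r))| ≤ 2 * α * ε := by
    intro r hr
    have hr1 : 1 ≤ r := hA.trans hr
    have hr0 : 0 ≤ r := zero_le_one.trans hr1
    rw [abs_mul, abs_mul (r ^ (k + 1)), abs_of_nonneg (pow_nonneg hr0 _),
      abs_of_pos (by positivity : 0 < 2 * α)]
    refine mul_le_mul_of_nonneg_left (le_trans ?_ (hdec r hr).1) (by positivity)
    gcongr
    omega
  have h₁ : |∫ r in A..B, (2 * β * r ^ (k + 1) - 2 * α * k * r ^ k) * (P t r * pR P t r)|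
      ≤ (2 * |β| + 6 * α) * ε := by
    refine abs_integral_le_of_sq_mul_le (by positivity) hA hAB fun r hr => ?_
    have hr1 : 1 ≤ r := hA.trans hr.1
    have hr0 : 0 ≤ r := zero_le_one.trans hr1
    have hc : |2 * β * r ^ (k + 1) - 2 * α * k * r ^ k| ≤ (2 * |β| + 6 * α) * r ^ 4 := by
      refine (abs_sub _ _).trans ?_
      rw [abs_mul, abs_mul, abs_two, abs_of_nonneg (pow_nonneg hr0 _),
        abs_of_nonneg (by positivity : 0 ≤ 2 * α * k * r ^ k), add_mul]
      refine add_le_add ?_ ?_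
      · gcongr
        omega
      · have : 2 * α * k ≤ 6 * α := by nlinarith
        gcongr
        omega
    rw [abs_mul]
    calc r ^ 2 * (|2 * β * r ^ (k + 1) - 2 * α * k * r ^ k| * |P t r * pR P t r|)
        ≤ r ^ 2 * ((2 * |β| + 6 * α) * r ^ 4 * |P t r * pR P t r|) := by gcongr
      _ = (2 * |β| + 6 * α) * (r ^ 6 * |P t r * pR P t r|) := by ring
      _ ≤ (2 * |β| + 6 * α) * ε := by gcongr; exact (hdec r hr.1).1
  have h₂ : |∫ r in A..B, 2 * r ^ (k + 1) * P t r ^ 2| ≤ 2 * ε := by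
    refine abs_integral_le_of_sq_mul_le (by positivity) hA hAB fun r hr => ?_
    have hr1 : 1 ≤ r := hA.trans hr.1
    have hr0 : 0 ≤ r := zero_le_one.trans hr1
    rw [abs_of_nonneg (by positivity)]
    calc r ^ 2 * (2 * r ^ (k + 1) * P t r ^ 2) ≤ r ^ 2 * (2 * r ^ 4 * P t r ^ 2) := by
          gcongr
          omega
      _ = 2 * (r ^ 6 * P t r ^ 2) := by ring
      _ ≤ 2 * ε := by gcongr; exact (hdec r hr.1).2
  rw [hP.energy_identity h2α ht hA0 hAB k]
  have hB := abs_le.1 (hbd B hAB)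
  have hA' := abs_le.1 (hbd A le_rfl)
  rw [abs_le] at h₁ h₂ ⊢
  constructor <;> linarith

/-- A quadratic cutoff on `[A, B]` with slope at most one. -/
theorem exists_cutoff (hA : 0 ≤ A) (hAB : A + 4 ≤ B) :
    ∃ ψ ψ' : ℝ → ℝ, (∀ r, HasDerivAt ψ (ψ' r) r) ∧ Continuous ψ' ∧ ψ A = 0 ∧ ψ B = 0 ∧
      (∀ r ∈ Icc A B, 0 ≤ ψ r ∧ ψ r ≤ r ∧ ψ' r ^ 2 ≤ 1) ∧
      ∀ r ∈ Icc (A + 2) (B - 2), 1 ≤ ψ r := by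
  have hL : 0 < B - A := by linarith
  refine ⟨fun r => (r - A) * (B - r) / (B - A), fun r => (A + B - 2 * r) / (B - A),
    fun r => ?_, by fun_prop, by simp, by simp, fun r hr => ⟨?_, ?_, ?_⟩, fun r hr => ?_⟩
  · have := (((hasDerivAt_id r).sub_const A).mul ((hasDerivAt_id r).const_sub B)).div_const (B - A)
    refine this.congr_deriv ?_
    simp only [id]
    ring
  · exact div_nonneg (mul_nonneg (by linarith [hr.1]) (by linarith [hr.2])) hL.le
  · rw [div_le_iff₀ hL]
    nlinarith [hr.1, hr.2, mul_nonneg (sub_nonneg.2 hr.1) (sub_nonneg.2 hr.1), mul_nonneg hA hL.le]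
  · rw [sq_le_one_iff_abs_le_one, abs_div, abs_of_pos hL, div_le_one hL, abs_le]
    constructor <;> linarith [hr.1, hr.2]
  · rw [le_div_iff₀ hL]
    nlinarith [hr.1, hr.2, mul_nonneg (sub_nonneg.2 hr.1) (sub_nonneg.2 hr.2)]

theorem cutoff_dissipation_le {p a q s r ψ ψ' : ℝ} (hα : 0 < α)
    (hpde : a = α * (r * s + q) + β * r * q - r * p) (hr : 1 ≤ r) (hψ0 : 0 ≤ ψ) (hψ : ψ ≤ r)
    (hψ' : ψ' ^ 2 ≤ 1) :
    -a * ((2 * ψ * ψ' * r + ψ ^ 2) * (q + q) + ψ ^ 2 * r * (s + s)) ≤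
      (8 * α + 2 * β ^ 2 / α) * (r ^ 4 * q ^ 2) + 2 / α * (r ^ 4 * p ^ 2) := by
  have hψr : ψ ^ 2 ≤ r ^ 2 := by gcongr
  have hψr' : ψ' ^ 2 ≤ r ^ 2 := hψ'.trans (one_le_pow₀ hr)
  have hdiv : r * s + q = (a - β * r * q + r * p) / α := by
    rw [eq_div_iff hα.ne', hpde]; ring
  have hbound : ∀ {x y : ℝ}, x ^ 2 ≤ r ^ 2 → (x * r * y) ^ 2 ≤ r ^ 4 * y ^ 2 := by
    intro x y hx
    calc (x * r * y) ^ 2 = x ^ 2 * (r ^ 2 * y ^ 2) := by ring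
      _ ≤ r ^ 2 * (r ^ 2 * y ^ 2) := by gcongr
      _ = r ^ 4 * y ^ 2 := by ring
  have hy : (ψ' * r * q) ^ 2 ≤ r ^ 4 * q ^ 2 := hbound hψr'
  have hz : (ψ * r * q) ^ 2 ≤ r ^ 4 * q ^ 2 := hbound hψr
  have hu : (ψ * r * p) ^ 2 ≤ r ^ 4 * p ^ 2 := hbound hψr
  calc -a * ((2 * ψ * ψ' * r + ψ ^ 2) * (q + q) + ψ ^ 2 * r * (s + s))
      = -(4 * (ψ * a) * (ψ' * r * q)) - 2 * ψ ^ 2 * a * (r * s + q) := by ring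
    _ = 8 * α * (ψ' * r * q) ^ 2 + 2 * β ^ 2 / α * (ψ * r * q) ^ 2
          + 2 / α * (ψ * r * p) ^ 2
          - ((ψ * a + 4 * α * (ψ' * r * q)) ^ 2 + (ψ * a - 2 * β * (ψ * r * q)) ^ 2
            + (ψ * a + 2 * (ψ * r * p)) ^ 2 + (ψ * a) ^ 2) / (2 * α) := by
        rw [hdiv]; field_simp; ring
    _ ≤ 8 * α * (ψ' * r * q) ^ 2 + 2 * β ^ 2 / α * (ψ * r * q) ^ 2
          + 2 / α * (ψ * r * p) ^ 2 := sub_le_self _ (by positivity)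
    _ ≤ 8 * α * (r ^ 4 * q ^ 2) + 2 * β ^ 2 / α * (r ^ 4 * q ^ 2)
          + 2 / α * (r ^ 4 * p ^ 2) := by gcongr
    _ = (8 * α + 2 * β ^ 2 / α) * (r ^ 4 * q ^ 2) + 2 / α * (r ^ 4 * p ^ 2) := by ring

theorem integral_cutoff_dissipation_le (hP : IsCompleteSolution σ α β (1 / 2) T P)
    (h2α : 2 * α = σ ^ 2) (hα : 0 < α) (ht : t ∈ Ioo 0 T) (hA : 1 ≤ A) (hAB : A ≤ B)
    {ε : ℝ} (hdec : ∀ r, A ≤ r → r ^ 6 * P t r ^ 2 ≤ ε) {ψ ψ' : ℝ → ℝ}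
    (hψc : Continuous ψ) (hψ'c : Continuous ψ')
    (hψ : ∀ r ∈ Icc A B, 0 ≤ ψ r ∧ ψ r ≤ r ∧ ψ' r ^ 2 ≤ 1) :
    (∫ r in A..B, -pTau P t r * ((2 * ψ r * ψ' r * r + ψ r ^ 2) * (pR P t r + pR P t r)
        + ψ r ^ 2 * r * (pRR P t r + pRR P t r))) ≤
      (8 * α + 2 * β ^ 2 / α) * (∫ r in A..B, r ^ 4 * pR P t r ^ 2) + 2 / α * ε := by
  have hA0 : 0 ≤ A := zero_le_one.trans hA
  have hε : 0 ≤ ε := le_trans (by positivity) (hdec A le_rfl)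
  have c0 := hP.continuousOn_slice (B := B) ht hA0
  have c1 := hP.continuousOn_pR_slice (B := B) ht hA0
  have c2 := hP.continuousOn_pRR_slice (B := B) ht hA0
  have cτ := hP.continuousOn_pTau_slice (B := B) ht hA0
  have iH : IntervalIntegrable (fun r => r ^ 4 * pR P t r ^ 2) volume A B :=
    ContinuousOn.intervalIntegrable_of_Icc hAB (by fun_prop)
  have iP : IntervalIntegrable (fun r => r ^ 4 * P t r ^ 2) volume A B :=
    ContinuousOn.intervalIntegrable_of_Icc hAB (by fun_prop)
  have hPε : ∫ r in A..B, r ^ 4 * P t r ^ 2 ≤ ε := by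
    refine (le_abs_self _).trans (abs_integral_le_of_sq_mul_le hε hA hAB fun r hr => ?_)
    rw [abs_of_nonneg (by positivity), ← mul_assoc, ← pow_add]
    exact hdec r hr.1
  have hmono := intervalIntegral.integral_mono_on (μ := volume) hAB
    (f := fun r => -pTau P t r * ((2 * ψ r * ψ' r * r + ψ r ^ 2) * (pR P t r + pR P t r)
        + ψ r ^ 2 * r * (pRR P t r + pRR P t r)))
    (ContinuousOn.intervalIntegrable_of_Icc hAB (by fun_prop))
    ((iH.const_mul (8 * α + 2 * β ^ 2 / α)).add (iP.const_mul (2 / α))) fun r hr =>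
      have hr1 := hA.trans hr.1
      cutoff_dissipation_le hα (hP.pde_cir h2α ht (one_pos.trans_le hr1)) hr1
        (hψ r hr).1 (hψ r hr).2.1 (hψ r hr).2.2
  rw [intervalIntegral.integral_add (iH.const_mul _) (iP.const_mul (2 / α)),
    intervalIntegral.integral_const_mul, intervalIntegral.integral_const_mul] at hmono
  refine hmono.trans ?_
  gcongr

/-- Uniform smallness in time of the tails of the dissipation, away from the initial time. -/
theorem exists_dissipation_tail_le (hP : IsCompleteSolution σ α β (1 / 2) T P)
    (h2α : 2 * α = σ ^ 2) (hα : 0 < α) {s₀ d : ℝ} (hs₀ : s₀ ∈ Ioo 0 T) (hd : 0 < d)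
    {ε : ℝ} (hε : 0 < ε) :
    ∃ A₁, 1 ≤ A₁ ∧ ∀ A B, A₁ ≤ A → A ≤ B → ∀ t ∈ Ico (s₀ + d) T,
      ∫ r in A..B, r * pR P t r ^ 2 ≤ ε := by
  have hT : 0 < T := hs₀.1.trans hs₀.2
  set C := 8 * α + 2 * β ^ 2 / α
  set K := 10 * α + 2 * |β| + 2
  set lam := (1 + T * C) / (2 * α) with hlam
  set C' := T * (2 / α) + lam * K with hC'
  have hCpos : 0 < C := by positivity
  have hKpos : 0 < K := by positivity
  have hlampos : 0 < lam := by positivity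
  have hC'pos : 0 < C' := by positivity
  have hlamα : lam * (2 * α) = 1 + T * C := by rw [hlam]; field_simp
  set η := ε * d / (lam + C' * T) with hη
  have hηpos : 0 < η := by positivity
  obtain ⟨A₀, hA₀, hdec⟩ := hP.exists_decay hηpos
  refine ⟨A₀ + 2, by linarith, fun A' B' hA' hAB' t ht => ?_⟩
  obtain ⟨A, rfl⟩ : ∃ A, A' = A + 2 := ⟨A' - 2, by ring⟩
  obtain ⟨B, rfl⟩ : ∃ B, B' = B - 2 := ⟨B' + 2, by ring⟩
  have hAA : A₀ ≤ A := by linarith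
  have hA1 : 1 ≤ A := hA₀.trans hAA
  have hA0 : 0 ≤ A := zero_le_one.trans hA1
  have hAB : A ≤ B := by linarith
  obtain ⟨ψ, ψ', hψd, hψ'c, hψA, hψB, hψ, hψ1⟩ := exists_cutoff hA0 (by linarith : A + 4 ≤ B)
  have hψc : Continuous ψ := continuous_iff_continuousAt.2 fun r => (hψd r).continuousAt
  have hwd : ∀ r, HasDerivAt (fun r => ψ r ^ 2 * r) (2 * ψ r * ψ' r * r + ψ r ^ 2) r := fun r => by
    refine (((hψd r).pow 2).mul (hasDerivAt_id r)).congr_deriv ?_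
    simp only [id, Pi.pow_apply]
    ring
  have hwnn : ∀ r ∈ Icc A B, 0 ≤ ψ r ^ 2 * r := fun r hr =>
    mul_nonneg (sq_nonneg _) (hA0.trans hr.1)
  set W : ℝ → ℝ := fun s => ∫ r in A..B, ψ r ^ 2 * r * pR P s r ^ 2
  set E : ℝ → ℝ := fun s => ∫ r in A..B, r ^ 3 * P s r ^ 2
  set Φ : ℝ → ℝ := fun s => (s - s₀) * W s + lam * E s - C' * η * s with hΦ
  have hEle : ∀ s ∈ Ioo 0 T, E s ≤ η := fun s hs => by
    refine (le_abs_self _).trans (abs_integral_le_of_sq_mul_le hηpos.le hA1 hAB fun r hr => ?_)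
    have hr1 : 1 ≤ r := hA1.trans hr.1
    have hr0 : 0 ≤ r := zero_le_one.trans hr1
    rw [abs_of_nonneg (by positivity)]
    refine le_trans ?_ (hdec s hs r (hAA.trans hr.1)).2
    rw [← mul_assoc, ← pow_add]
    gcongr
    norm_num
  have hEnn : ∀ s, 0 ≤ E s := fun s => intervalIntegral.integral_nonneg hAB fun r hr => by
    have hr0 : 0 ≤ r := hA0.trans hr.1
    positivity
  have hder : ∀ s ∈ Ico s₀ T, ∃ D, HasDerivAt Φ D s ∧ D ≤ 0 := by
    intro s hs
    have hs' : s ∈ Ioo 0 T := ⟨hs₀.1.trans_le hs.1, hs.2⟩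
    have c1 := hP.continuousOn_pR_slice (B := B) hs' hA0
    have hWd := hP.hasDerivAt_integral_pR_sq hs' hA0 hAB hwd (by fun_prop) (by simp [hψA])
      (by simp [hψB])
    have hEd := hP.hasDerivAt_integral_sq hs' hA0 hAB (continuous_pow 3)
    refine ⟨_, ((((hasDerivAt_id s).sub_const s₀).mul hWd).add (hEd.const_mul lam)).sub
      ((hasDerivAt_id s).const_mul (C' * η)), ?_⟩
    set H := ∫ r in A..B, r ^ 4 * pR P s r ^ 2
    have iH : IntervalIntegrable (fun r => r ^ 4 * pR P s r ^ 2) volume A B :=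
      ContinuousOn.intervalIntegrable_of_Icc hAB (by fun_prop)
    have hHnn : 0 ≤ H := intervalIntegral.integral_nonneg hAB fun r hr => by positivity
    have hE' := (abs_le.1 (hP.abs_energy_add_dissipation_le h2α hα hs' hA1 hAB le_rfl
      fun r hr => hdec s hs' r (hAA.trans hr))).2
    have hWH : W s ≤ H := by
      refine intervalIntegral.integral_mono_on hAB
        (ContinuousOn.intervalIntegrable_of_Icc hAB (by fun_prop)) iH fun r hr => ?_
      have hr1 : 1 ≤ r := hA1.trans hr.1
      have hr0 : 0 ≤ r := zero_le_one.trans hr1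
      refine mul_le_mul_of_nonneg_right ?_ (sq_nonneg _)
      calc ψ r ^ 2 * r ≤ r ^ 2 * r := by gcongr; exacts [(hψ r hr).1, (hψ r hr).2.1]
        _ = r ^ 3 := by ring
        _ ≤ r ^ 4 := pow_le_pow_right₀ hr1 (by norm_num)
    have hW' := hP.integral_cutoff_dissipation_le h2α hα hs' hA1 hAB
      (fun r hr => (hdec s hs' r (hAA.trans hr)).2) hψc hψ'c hψ
    have hsT : (s - s₀) * (∫ r in A..B, -pTau P s r * ((2 * ψ r * ψ' r * r + ψ r ^ 2) *
        (pR P s r + pR P s r) + ψ r ^ 2 * r * (pRR P s r + pRR P s r))) ≤ T * (C * H + 2 / α * η) :=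
      (mul_le_mul_of_nonneg_left hW' (sub_nonneg.2 hs.1)).trans
        (mul_le_mul_of_nonneg_right (by linarith [hs.2, hs₀.1]) (by positivity))
    have hlE := mul_le_mul_of_nonneg_left hE' hlampos.le
    have hexp : C' * η = T * (2 / α * η) + lam * (K * η) := by rw [hC']; ring
    have hlH : lam * (2 * α * H) = H + T * (C * H) := by rw [← mul_assoc, hlamα]; ring
    rw [mul_add] at hlE hsT
    simp only [id, mul_one, one_mul]
    linarith
  have hanti : AntitoneOn Φ (Ico s₀ T) := by
    refine antitoneOn_of_deriv_nonpos (convex_Ico _ _) (fun s hs => ?_) (fun s hs => ?_)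
      fun s hs => ?_
    · obtain ⟨D, hD, -⟩ := hder s hs
      exact hD.continuousAt.continuousWithinAt
    · obtain ⟨D, hD, -⟩ := hder s (interior_subset hs)
      exact hD.differentiableAt.differentiableWithinAt
    · obtain ⟨D, hD, hD0⟩ := hder s (interior_subset hs)
      rwa [hD.deriv]
  have hst : s₀ ≤ t := by linarith [ht.1]
  have ht' : t ∈ Ioo 0 T := ⟨hs₀.1.trans_le hst, ht.2⟩
  have hcmp : Φ t ≤ Φ s₀ := hanti ⟨le_rfl, hs₀.2⟩ ⟨hst, ht.2⟩ hst
  have c1 := hP.continuousOn_pR_slice (B := B) ht' hA0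
  have iW : IntervalIntegrable (fun r => ψ r ^ 2 * r * pR P t r ^ 2) volume A B :=
    ContinuousOn.intervalIntegrable_of_Icc hAB (by fun_prop)
  have hsubI : Icc (A + 2) (B - 2) ⊆ Icc A B := Icc_subset_Icc (by linarith) (by linarith)
  have htail : ∫ r in (A + 2)..(B - 2), r * pR P t r ^ 2 ≤ W t := by
    refine (intervalIntegral.integral_mono_on hAB' (g := fun r => ψ r ^ 2 * r * pR P t r ^ 2)
      (ContinuousOn.intervalIntegrable_of_Icc hAB'
        (continuousOn_id.mul ((c1.mono hsubI).pow 2)))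
      (ContinuousOn.intervalIntegrable_of_Icc hAB'
        ((hψc.pow 2).mul continuous_id |>.continuousOn.mul ((c1.mono hsubI).pow 2)))
      fun r hr => ?_).trans ?_
    · have h1 := hψ1 r hr
      have hr0 : 0 ≤ r := by linarith [hr.1]
      refine mul_le_mul_of_nonneg_right ?_ (sq_nonneg _)
      exact le_mul_of_one_le_left hr0 (one_le_pow₀ h1)
    · refine intervalIntegral.integral_mono_interval (by linarith) hAB' (by linarith) ?_ iW
      filter_upwards [ae_restrict_mem measurableSet_Ioc] with r hr
      exact mul_nonneg (hwnn r (Ioc_subset_Icc_self hr)) (sq_nonneg _)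
  have hW0 : 0 ≤ W t := intervalIntegral.integral_nonneg hAB fun r hr =>
    mul_nonneg (hwnn r hr) (sq_nonneg _)
  have hdW : d * W t ≤ (t - s₀) * W t :=
    mul_le_mul_of_nonneg_right (by linarith [ht.1]) hW0
  have h1 : lam * E s₀ ≤ lam * η := mul_le_mul_of_nonneg_left (hEle s₀ hs₀) hlampos.le
  have h2 : 0 ≤ lam * E t := mul_nonneg hlampos.le (hEnn t)
  have h3 : C' * η * (t - s₀) ≤ C' * η * T :=
    mul_le_mul_of_nonneg_left (by linarith [ht.2, hs₀.1]) (by positivity)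
  have h4 : (lam + C' * T) * η = ε * d := by rw [hη]; field_simp
  simp only [hΦ, sub_self, zero_mul, zero_add] at hcmp
  have h5 : d * W t ≤ d * ε := by linarith
  exact htail.trans (le_of_mul_le_mul_left h5 hd)

theorem integrableOn_sq (hP : IsCompleteSolution σ α β γ T P) (ht : t ∈ Ioo 0 T) :
    IntegrableOn (fun r => P t r ^ 2) (Ioi 0) := by
  obtain ⟨A₀, hA₀, hdec⟩ := hP.exists_decay one_pos
  have hA0 : 0 ≤ A₀ := zero_le_one.trans hA₀
  have hc : ContinuousOn (fun r => P t r ^ 2) (Ici 0) := fun r hr =>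
    ((hP.hasDerivAt_r ht hr).continuousAt.pow 2).continuousWithinAt
  rw [← Ioc_union_Ioi_eq_Ioi hA0]
  refine IntegrableOn.union ?_ ?_
  · exact ((hc.mono Icc_subset_Ici_self).integrableOn_Icc).mono_set Ioc_subset_Icc_self
  · refine Integrable.mono' (integrableOn_Ioi_rpow_of_lt (by norm_num : (-2 : ℝ) < -1)
      (one_pos.trans_le hA₀)) ((hc.mono fun r hr => hA0.trans (le_of_lt hr)).aestronglyMeasurable
      measurableSet_Ioi) ?_
    filter_upwards [ae_restrict_mem measurableSet_Ioi] with r hr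
    have hr1 : 1 ≤ r := hA₀.trans (le_of_lt hr)
    have hr0 : 0 < r := one_pos.trans_le hr1
    have h2 : r ^ (-2 : ℝ) = (r ^ 2)⁻¹ := by
      rw [Real.rpow_neg hr0.le]
      norm_cast
    rw [Real.norm_eq_abs, abs_of_nonneg (sq_nonneg _), h2, ← one_div, le_div_iff₀ (by positivity),
      mul_comm]
    refine le_trans ?_ (hdec t ht r (le_of_lt hr)).2
    gcongr
    norm_num

/-- The time derivatives of the energies on `[0, n]` converge uniformly away from the initial
time. -/
theorem uniformCauchySeqOn_energy_deriv (hP : IsCompleteSolution σ α β (1 / 2) T P)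
    (h2α : 2 * α = σ ^ 2) (hα : 0 < α) {a : ℝ} (ha : a ∈ Ioo 0 T) :
    UniformCauchySeqOn (fun (n : ℕ) s => ∫ r in (0 : ℝ)..n, 2 * P s r * pTau P s r) atTop
      (Ioo a T) := by
  rw [Metric.uniformCauchySeqOn_iff]
  intro ε hε
  obtain ⟨A₀, hA₀, hdec⟩ := hP.exists_decay
    (ε := ε / (8 * (10 * α + 2 * |β| + 2))) (by positivity)
  obtain ⟨A₁, hA₁, htail⟩ := hP.exists_dissipation_tail_le h2α hα (s₀ := a / 2) (d := a / 2)
    ⟨by linarith [ha.1], by linarith [ha.1, ha.2]⟩ (by linarith [ha.1])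
    (ε := ε / (8 * (2 * α))) (by positivity)
  obtain ⟨N, hN⟩ := exists_nat_ge (max A₀ A₁)
  have hNA₀ : A₀ ≤ N := (le_max_left _ _).trans hN
  have hNA₁ : A₁ ≤ N := (le_max_right _ _).trans hN
  have hint : ∀ s ∈ Ioo a T, ∀ p q : ℕ,
      IntervalIntegrable (fun r => 2 * P s r * pTau P s r) volume p q := by
    intro s hs p q
    have hs' : s ∈ Ioo 0 T := ⟨ha.1.trans hs.1, hs.2⟩
    have key : ∀ n : ℕ, IntervalIntegrable (fun r => 2 * P s r * pTau P s r) volume 0 n :=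
      fun n => ContinuousOn.intervalIntegrable_of_Icc n.cast_nonneg
        ((continuousOn_const.mul (hP.continuousOn_slice hs' le_rfl)).mul
          (hP.continuousOn_pTau_slice hs' le_rfl))
    exact (key p).symm.trans (key q)
  have hclose : ∀ n : ℕ, N ≤ n → ∀ s ∈ Ioo a T,
      |(∫ r in (0 : ℝ)..n, 2 * P s r * pTau P s r) - ∫ r in (0 : ℝ)..N, 2 * P s r * pTau P s r|
        ≤ ε / 4 := by
    intro n hn s hs
    have hs' : s ∈ Ioo 0 T := ⟨ha.1.trans hs.1, hs.2⟩
    have hnN : (N : ℝ) ≤ n := by exact_mod_cast hn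
    have h1 := hP.abs_energy_add_dissipation_le h2α hα hs' (hA₀.trans hNA₀) hnN (k := 0)
      (by norm_num) fun r hr => hdec s hs' r (hNA₀.trans hr)
    have h2 := htail N n hNA₁ hnN s ⟨by linarith [hs.1], hs.2⟩
    have h3 : 0 ≤ ∫ r in (N : ℝ)..n, r * pR P s r ^ 2 :=
      intervalIntegral.integral_nonneg hnN fun r hr =>
        mul_nonneg (N.cast_nonneg.trans hr.1) (sq_nonneg _)
    have h4 : (10 * α + 2 * |β| + 2) * (ε / (8 * (10 * α + 2 * |β| + 2))) = ε / 8 := by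
      field_simp
    have h5 := mul_le_mul_of_nonneg_left h2 (by positivity : 0 ≤ 2 * α)
    have h6 : 2 * α * (ε / (8 * (2 * α))) = ε / 8 := by field_simp
    have h7 := mul_nonneg (by positivity : 0 ≤ 2 * α) h3
    simp only [pow_zero, one_mul, zero_add, pow_one] at h1
    have h0 := hint s hs 0 n
    have h0' := hint s hs 0 N
    rw [Nat.cast_zero] at h0 h0'
    rw [h4, abs_le] at h1
    rw [intervalIntegral.integral_interval_sub_left h0 h0', abs_le]
    constructor <;> linarith
  refine ⟨N, fun m hm n hn s hs => ?_⟩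
  have h1 := abs_le.1 (hclose m hm s hs)
  have h2 := abs_le.1 (hclose n hn s hs)
  rw [Real.dist_eq, abs_lt]
  constructor <;> linarith

/-- Integration by parts on `[0, B]`, dropping the dissipative terms. -/
theorem energy_deriv_add_le (hP : IsCompleteSolution σ α β (1 / 2) T P) (h2α : 2 * α = σ ^ 2)
    (hα : 0 < α) (ht : t ∈ Ioo 0 T) (hB : 0 ≤ B) :
    (∫ r in (0 : ℝ)..B, 2 * P t r * pTau P t r) + β * ∫ r in (0 : ℝ)..B, P t r ^ 2 ≤
      2 * α * (B * (P t B * pR P t B)) + β * (B * P t B ^ 2) := by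
  have c0 := hP.continuousOn_slice (B := B) ht le_rfl
  have c1 := hP.continuousOn_pR_slice (B := B) ht le_rfl
  have h := hP.energy_identity h2α ht le_rfl hB 0
  have i₁ : IntervalIntegrable (fun r => 2 * β * r * (P t r * pR P t r)) volume 0 B :=
    ContinuousOn.intervalIntegrable_of_Icc hB (by fun_prop)
  have i₂ : IntervalIntegrable (fun r => β * P t r ^ 2) volume 0 B :=
    ContinuousOn.intervalIntegrable_of_Icc hB (by fun_prop)
  have hFTC := intervalIntegral.integral_eq_sub_of_hasDerivAt (a := 0) (b := B)
    (f := fun r => β * (r * P t r ^ 2))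
    (f' := fun r => 2 * β * r * (P t r * pR P t r) + β * P t r ^ 2)
    (fun r hr => by
      rw [uIcc_of_le hB] at hr
      refine (((hasDerivAt_id r).mul ((hP.hasDerivAt_r ht hr.1).pow 2)).const_mul β).congr_deriv ?_
      simp only [id, Pi.pow_apply]
      ring) (i₁.add i₂)
  rw [intervalIntegral.integral_add i₁ i₂, intervalIntegral.integral_const_mul] at hFTC
  have h1 : 0 ≤ ∫ r in (0 : ℝ)..B, r * pR P t r ^ 2 :=
    intervalIntegral.integral_nonneg hB fun r hr => mul_nonneg hr.1 (sq_nonneg _)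
  have h2 : 0 ≤ ∫ r in (0 : ℝ)..B, 2 * r * P t r ^ 2 :=
    intervalIntegral.integral_nonneg hB fun r hr =>
      mul_nonneg (mul_nonneg zero_le_two hr.1) (sq_nonneg _)
  have h3 := mul_nonneg (by positivity : 0 ≤ 2 * α) h1
  simp only [pow_zero, one_mul, zero_add, pow_one, Nat.cast_zero, mul_zero, zero_mul,
    sub_zero] at h hFTC
  linarith

end IsCompleteSolution

/-- CIR model with `2α = σ²`. Any complete solution satisfies
`d/dτ ∫₀^∞ P² ≤ K ∫₀^∞ P²` with `K = -β`. -/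
theorem energy_inequality_CIR_equality_case (σ α β T : ℝ) (hσ : 0 < σ) (hα : 0 < α)
    (hT : 0 < T) (h2α : 2*α = σ^2)
    (P : ℝ → ℝ → ℝ) (hP : IsCompleteSolution σ α β (1/2) T P) :
    ∀ τ ∈ Ioo (0:ℝ) T, ∃ D : ℝ,
      HasDerivAt (fun t => ∫ r in Ioi (0:ℝ), (P t r)^2) D τ ∧
      D ≤ (-β) * ∫ r in Ioi (0:ℝ), (P τ r)^2 := by
  intro τ hτ
  have ha : τ / 2 ∈ Ioo 0 T := ⟨by linarith [hτ.1], by linarith [hτ.1, hτ.2]⟩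
  have hτ' : τ ∈ Ioo (τ / 2) T := ⟨by linarith [hτ.1], hτ.2⟩
  have hcauchy := hP.uniformCauchySeqOn_energy_deriv h2α hα ha
  have hex : ∀ s, ∃ l, s ∈ Ioo (τ / 2) T →
      Tendsto (fun n : ℕ => ∫ r in (0 : ℝ)..n, 2 * P s r * pTau P s r) atTop (𝓝 l) := by
    intro s
    by_cases hs : s ∈ Ioo (τ / 2) T
    · obtain ⟨l, hl⟩ := cauchySeq_tendsto_of_complete (hcauchy.cauchySeq hs)
      exact ⟨l, fun _ => hl⟩
    · exact ⟨0, fun h => absurd h hs⟩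
  choose g hg using hex
  have hlim : ∀ s ∈ Ioo 0 T, Tendsto (fun n : ℕ => ∫ r in (0 : ℝ)..n, P s r ^ 2) atTop
      (𝓝 (∫ r in Ioi (0 : ℝ), P s r ^ 2)) := fun s hs =>
    intervalIntegral_tendsto_integral_Ioi 0 (hP.integrableOn_sq hs) tendsto_natCast_atTop_atTop
  have hsub : ∀ s ∈ Ioo (τ / 2) T, s ∈ Ioo 0 T := fun s hs => ⟨ha.1.trans hs.1, hs.2⟩
  refine ⟨g τ, hasDerivAt_of_tendstoUniformlyOn isOpen_Ioo
    (hcauchy.tendstoUniformlyOn_of_tendsto hg) (Eventually.of_forall fun n s hs => ?_)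
    (fun s hs => hlim s (hsub s hs)) hτ', ?_⟩
  · simpa using hP.hasDerivAt_integral_sq (hsub s hs) le_rfl (Nat.cast_nonneg n)
      (continuous_const (y := (1 : ℝ)))
  · have htend := (hg τ hτ').add ((hlim τ hτ).const_mul β)
    suffices h : g τ + β * ∫ r in Ioi (0 : ℝ), P τ r ^ 2 ≤ 0 by linarith
    refine le_of_forall_pos_le_add fun ε hε => le_of_tendsto htend ?_
    obtain ⟨A₀, hA₀, hdec⟩ := hP.exists_decay (ε := ε / (2 * α + |β|)) (by positivity)
    filter_upwards [tendsto_natCast_atTop_atTop.eventually_ge_atTop A₀] with n hn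
    have hn1 : (1 : ℝ) ≤ n := hA₀.trans hn
    have hn6 : (n : ℝ) ≤ (n : ℝ) ^ 6 := le_self_pow₀ hn1 (by norm_num)
    obtain ⟨h1, h2⟩ := hdec τ hτ n hn
    refine (hP.energy_deriv_add_le h2α hα hτ n.cast_nonneg).trans ?_
    rw [zero_add]
    have h3 : (n : ℝ) * (P τ n * pR P τ n) ≤ ε / (2 * α + |β|) := calc
      (n : ℝ) * (P τ n * pR P τ n) ≤ n * |P τ n * pR P τ n| :=
        mul_le_mul_of_nonneg_left (le_abs_self (P τ n * pR P τ n)) n.cast_nonneg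
      _ ≤ (n : ℝ) ^ 6 * |P τ n * pR P τ n| := mul_le_mul_of_nonneg_right hn6 (abs_nonneg _)
      _ ≤ ε / (2 * α + |β|) := h1
    have h4 : (n : ℝ) * P τ n ^ 2 ≤ ε / (2 * α + |β|) :=
      (mul_le_mul_of_nonneg_right hn6 (sq_nonneg _)).trans h2
    calc 2 * α * (n * (P τ n * pR P τ n)) + β * (n * P τ n ^ 2)
        ≤ 2 * α * (ε / (2 * α + |β|)) + |β| * (n * P τ n ^ 2) :=
          add_le_add (mul_le_mul_of_nonneg_left h3 (by positivity))
            (mul_le_mul_of_nonneg_right (le_abs_self β) (by positivity))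
      _ ≤ 2 * α * (ε / (2 * α + |β|)) + |β| * (ε / (2 * α + |β|)) := by gcongr
      _ = ε := by field_simp
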